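/- Let Ω = {(q1,q2,q3,q4,q5) ∈ ℝ⁵ : 0 < q2 < π, 0 < q3 < π, 0 < q4 < π, q5 > 0}, H2 = (1/2)p2² + (2/sin²q2)·p1², H3 = (1/2)p3² + (4/sin²q3)·H2, H'4 = (1/2)p4² + (4/sin²q4)·H3, H5 = (1/2)p5² + (4/(q5)²)·H'4, and K5 = cos(q4)·p5² − 4·sin(q4)·(1/q5)·p4·p5 − 8·cos(q4)·(1/(q5)²)·H'4. Then {H5, K5} = 0 at every point of Ω × ℝ⁵. -/

import Mathlib

open Real

/-- Partial derivative of `F(q,p)` with respect to the coordinate `q i`. -/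
noncomputable def pdq {n : ℕ} (i : Fin n) (F : (Fin n → ℝ) → (Fin n → ℝ) → ℝ)
    (q p : Fin n → ℝ) : ℝ :=
  deriv (fun t => F (Function.update q i t) p) (q i)

/-- Partial derivative of `F(q,p)` with respect to the momentum `p i`. -/
noncomputable def pdp {n : ℕ} (i : Fin n) (F : (Fin n → ℝ) → (Fin n → ℝ) → ℝ)
    (q p : Fin n → ℝ) : ℝ :=
  deriv (fun t => F q (Function.update p i t)) (p i)

/-- Canonical Poisson bracket `{F,G} = ∑ i, (∂F/∂qⁱ ∂G/∂pᵢ − ∂F/∂pᵢ ∂G/∂qⁱ)`. -/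
noncomputable def poissonBracket {n : ℕ} (F G : (Fin n → ℝ) → (Fin n → ℝ) → ℝ)
    (q p : Fin n → ℝ) : ℝ :=
  ∑ i, (pdq i F q p * pdp i G q p - pdp i F q p * pdq i G q p)

/-- `H2 = (1/2)p2² + (2/sin²q2) p1²`. -/
noncomputable def H2 (q p : Fin 5 → ℝ) : ℝ :=
  (1/2) * (p 1)^2 + (2/(sin (q 1))^2) * (p 0)^2

/-- `H3 = (1/2)p3² + (4/sin²q3) H2`. -/
noncomputable def H3 (q p : Fin 5 → ℝ) : ℝ :=
  (1/2) * (p 2)^2 + (4/(sin (q 2))^2) * H2 q p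

/-- `H'4 = (1/2)p4² + (4/sin²q4) H3`. -/
noncomputable def H4' (q p : Fin 5 → ℝ) : ℝ :=
  (1/2) * (p 3)^2 + (4/(sin (q 3))^2) * H3 q p

/-- `H5 = (1/2)p5² + (4/(q5)²) H'4`. -/
noncomputable def H5 (q p : Fin 5 → ℝ) : ℝ :=
  (1/2) * (p 4)^2 + (4/(q 4)^2) * H4' q p

/-- `K5`, the additional quadratic first integral produced by the extension. -/
noncomputable def K5 (q p : Fin 5 → ℝ) : ℝ :=
  cos (q 3) * (p 4)^2 - 4 * sin (q 3) * (1/(q 4)) * (p 3) * (p 4) -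
    8 * cos (q 3) * (1/(q 4)^2) * H4' q p

theorem H4'_eq (q p : Fin 5 → ℝ) :
    H4' q p = (1/2) * (p 3)^2 + (4/(sin (q 3))^2) * H3 q p := rfl

/-- `H5` depends on the first three pairs of canonical coordinates only through `H4'`. -/
theorem pdq_H5_of_ne {i : Fin 5} (hi4 : i ≠ 4) (q p : Fin 5 → ℝ) :
    pdq i H5 q p = (4/(q 4)^2) * pdq i H4' q p := by
  simp only [pdq, H5, Function.update_of_ne hi4.symm]
  rw [deriv_const_add, deriv_const_mul_field]

theorem pdp_H5_of_ne {i : Fin 5} (hi4 : i ≠ 4) (q p : Fin 5 → ℝ) :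
    pdp i H5 q p = (4/(q 4)^2) * pdp i H4' q p := by
  simp only [pdp, H5, Function.update_of_ne hi4.symm]
  rw [deriv_const_add, deriv_const_mul_field]

/-- `K5` depends on the first three pairs of canonical coordinates only through `H4'`. -/
theorem pdq_K5_of_ne {i : Fin 5} (hi3 : i ≠ 3) (hi4 : i ≠ 4) (q p : Fin 5 → ℝ) :
    pdq i K5 q p = -(8 * cos (q 3) * (1/(q 4)^2) * pdq i H4' q p) := by
  simp only [pdq, K5, Function.update_of_ne hi3.symm, Function.update_of_ne hi4.symm]
  rw [deriv_const_sub, deriv_const_mul_field]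

theorem pdp_K5_of_ne {i : Fin 5} (hi3 : i ≠ 3) (hi4 : i ≠ 4) (q p : Fin 5 → ℝ) :
    pdp i K5 q p = -(8 * cos (q 3) * (1/(q 4)^2) * pdp i H4' q p) := by
  simp only [pdp, K5, Function.update_of_ne hi3.symm, Function.update_of_ne hi4.symm]
  rw [deriv_const_sub, deriv_const_mul_field]

theorem bracket_term_eq_zero {i : Fin 5} (hi3 : i ≠ 3) (hi4 : i ≠ 4) (q p : Fin 5 → ℝ) :
    pdq i H5 q p * pdp i K5 q p - pdp i H5 q p * pdq i K5 q p = 0 := by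
  rw [pdq_H5_of_ne hi4, pdp_H5_of_ne hi4, pdq_K5_of_ne hi3 hi4, pdp_K5_of_ne hi3 hi4]
  ring

theorem H4'_update_q_three (q p : Fin 5 → ℝ) (t : ℝ) :
    H4' (Function.update q 3 t) p = (1/2) * (p 3)^2 + (4/(sin t)^2) * H3 q p := by
  simp [H4', H3, H2]

theorem H4'_update_p_three (q p : Fin 5 → ℝ) (t : ℝ) :
    H4' q (Function.update p 3 t) = (1/2) * t^2 + (4/(sin (q 3))^2) * H3 q p := by
  simp [H4', H3, H2]

theorem H4'_update_q_four (q p : Fin 5 → ℝ) (t : ℝ) :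
    H4' (Function.update q 4 t) p = H4' q p := by
  simp [H4', H3, H2]

theorem H4'_update_p_four (q p : Fin 5 → ℝ) (t : ℝ) :
    H4' q (Function.update p 4 t) = H4' q p := by
  simp [H4', H3, H2]

theorem hasDerivAt_const_div_sq (c : ℝ) {x : ℝ} (hx : x ≠ 0) :
    HasDerivAt (fun t => c/t^2) (-(2*c)/x^3) x := by
  refine ((hasDerivAt_const x c).div (hasDerivAt_pow 2 x) (pow_ne_zero 2 hx)).congr_deriv ?_
  field_simp
  ring

theorem hasDerivAt_H4'_q_three (q p : Fin 5 → ℝ) (hs : sin (q 3) ≠ 0) :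
    HasDerivAt (fun t => H4' (Function.update q 3 t) p)
      (-8 * cos (q 3) / (sin (q 3))^3 * H3 q p) (q 3) := by
  simp only [H4'_update_q_three]
  refine ((((hasDerivAt_const_div_sq 4 hs).comp (q 3) (hasDerivAt_sin (q 3))).mul_const
    (H3 q p)).const_add ((1/2) * (p 3)^2)).congr_deriv ?_
  ring

theorem hasDerivAt_H4'_p_three (q p : Fin 5 → ℝ) :
    HasDerivAt (fun t => H4' q (Function.update p 3 t)) (p 3) (p 3) := by
  simp only [H4'_update_p_three]
  refine (((hasDerivAt_pow 2 (p 3)).const_mul (1/2)).add_const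
    ((4/(sin (q 3))^2) * H3 q p)).congr_deriv ?_
  ring

theorem pdq_three_H5 (q p : Fin 5 → ℝ) (hs : sin (q 3) ≠ 0) :
    pdq 3 H5 q p = (4/(q 4)^2) * (-8 * cos (q 3) / (sin (q 3))^3 * H3 q p) := by
  rw [pdq_H5_of_ne (by decide)]
  exact congrArg _ (hasDerivAt_H4'_q_three q p hs).deriv

theorem pdp_three_H5 (q p : Fin 5 → ℝ) : pdp 3 H5 q p = (4/(q 4)^2) * p 3 := by
  rw [pdp_H5_of_ne (by decide)]
  exact congrArg _ (hasDerivAt_H4'_p_three q p).deriv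

theorem pdq_four_H5 (q p : Fin 5 → ℝ) (hu : q 4 ≠ 0) :
    pdq 4 H5 q p = -8/(q 4)^3 * H4' q p := by
  simp only [pdq, H5, H4'_update_q_four, Function.update_self]
  convert (((hasDerivAt_const_div_sq 4 hu).mul_const (H4' q p)).const_add
    ((1/2) * (p 4)^2)).deriv using 1
  ring

theorem pdp_four_H5 (q p : Fin 5 → ℝ) : pdp 4 H5 q p = p 4 := by
  simp only [pdp, H5, H4'_update_p_four, Function.update_self]
  convert (((hasDerivAt_pow 2 (p 4)).const_mul (1/2)).add_const
    ((4/(q 4)^2) * H4' q p)).deriv using 1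
  ring

theorem pdq_three_K5 (q p : Fin 5 → ℝ) (hs : sin (q 3) ≠ 0) :
    pdq 3 K5 q p = -sin (q 3) * (p 4)^2 - 4 * cos (q 3) * (1/(q 4)) * (p 3) * (p 4) +
      8 * sin (q 3) * (1/(q 4)^2) * H4' q p -
      8 * cos (q 3) * (1/(q 4)^2) * (-8 * cos (q 3) / (sin (q 3))^3 * H3 q p) := by
  have hc := hasDerivAt_cos (q 3)
  have key := ((hc.mul_const ((p 4)^2)).sub
    (((((hasDerivAt_sin (q 3)).const_mul 4).mul_const (1/(q 4))).mul_const (p 3)).mul_const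
      (p 4))).sub (((hc.const_mul 8).mul_const (1/(q 4)^2)).mul (hasDerivAt_H4'_q_three q p hs))
  simp only [Function.update_eq_self] at key
  simp only [pdq, K5, Function.update_self, Function.update_of_ne (show (4 : Fin 5) ≠ 3 by decide)]
  refine key.deriv.trans ?_
  ring

theorem pdp_three_K5 (q p : Fin 5 → ℝ) :
    pdp 3 K5 q p = -4 * sin (q 3) * (1/(q 4)) * (p 4) -
      8 * cos (q 3) * (1/(q 4)^2) * p 3 := by
  have key := ((((hasDerivAt_id (p 3)).const_mul (4 * sin (q 3) * (1/(q 4)))).mul_const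
    (p 4)).const_sub (cos (q 3) * (p 4)^2)).sub
    ((hasDerivAt_H4'_p_three q p).const_mul (8 * cos (q 3) * (1/(q 4)^2)))
  simp only [pdp, K5, Function.update_self, Function.update_of_ne (show (4 : Fin 5) ≠ 3 by decide)]
  refine key.deriv.trans ?_
  ring

theorem pdq_four_K5 (q p : Fin 5 → ℝ) (hu : q 4 ≠ 0) :
    pdq 4 K5 q p = 4 * sin (q 3) * (1/(q 4)^2) * (p 3) * (p 4) +
      16 * cos (q 3) * (1/(q 4)^3) * H4' q p := by
  have key := ((((((hasDerivAt_const (q 4) (1 : ℝ)).div (hasDerivAt_id (q 4)) hu).const_mul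
    (4 * sin (q 3))).mul_const (p 3)).mul_const (p 4)).const_sub (cos (q 3) * (p 4)^2)).sub
    (((hasDerivAt_const_div_sq 1 hu).const_mul (8 * cos (q 3))).mul_const (H4' q p))
  simp only [pdq, K5, H4'_update_q_four, Function.update_self,
    Function.update_of_ne (show (3 : Fin 5) ≠ 4 by decide)]
  refine key.deriv.trans ?_
  simp only [id]
  ring

theorem pdp_four_K5 (q p : Fin 5 → ℝ) :
    pdp 4 K5 q p = 2 * cos (q 3) * p 4 - 4 * sin (q 3) * (1/(q 4)) * p 3 := by
  have key := (((hasDerivAt_pow 2 (p 4)).const_mul (cos (q 3))).sub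
    ((hasDerivAt_id (p 4)).const_mul (4 * sin (q 3) * (1/(q 4)) * p 3))).sub_const
    (8 * cos (q 3) * (1/(q 4)^2) * H4' q p)
  simp only [pdp, K5, H4'_update_p_four, Function.update_self,
    Function.update_of_ne (show (3 : Fin 5) ≠ 4 by decide)]
  refine key.deriv.trans ?_
  ring

theorem stmt_17 (q p : Fin 5 → ℝ) (h2 : 0 < q 1) (h2' : q 1 < π)
    (h3 : 0 < q 2) (h3' : q 2 < π) (h4 : 0 < q 3) (h4' : q 3 < π) (h5 : 0 < q 4) :
    poissonBracket H5 K5 q p = 0 := by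
  have hs : sin (q 3) ≠ 0 := (sin_pos_of_pos_of_lt_pi h4 h4').ne'
  have hu : q 4 ≠ 0 := h5.ne'
  rw [poissonBracket, Fin.sum_univ_five, bracket_term_eq_zero (by decide) (by decide),
    bracket_term_eq_zero (by decide) (by decide), bracket_term_eq_zero (by decide) (by decide),
    pdq_three_H5 q p hs, pdp_three_H5, pdq_four_H5 q p hu, pdp_four_H5,
    pdq_three_K5 q p hs, pdp_three_K5, pdq_four_K5 q p hu, pdp_four_K5, H4'_eq]
  field_simp
  ring
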